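/- arXiv:2105.07724 — 2 statements merged into one kernel-verified Lean document; each statement's English description precedes it below -/
import Mathlib

section
/- The quantum Lucas theorem: in mixed characteristic (p, ℓ), for V with pℓ-adic digits (a_j,...,a_0) and W with digits (b_j,...,b_0), the quantum binomial satisfies binom_q(V, W) = ε · binom(a_j, b_j) · ... · binom(a_1, b_1) · binom_q(a_0, b_0), where ε = (q^ℓ)^{A_1 b_0 + a_0 B_1 + ℓ(A_1 B_1 - B_1^2)} = ±1 with A_1 = (V - a_0)/ℓ, B_1 = (W - b_0)/ℓ. -/
/-- `plpow p ℓ 0 = 1` and `plpow p ℓ i = p^(i-1) * ℓ` for `i ≥ 1`. -/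
def plpow (p ℓ : ℕ) : ℕ → ℕ
  | 0 => 1
  | i + 1 => p ^ i * ℓ

/-- The balanced quantum integer `[n]_q = (q^n - q^{-n})/(q - q^{-1})`. -/
noncomputable def qnum {k : Type*} [Field k] (q : k) (n : ℕ) : k :=
  (q ^ (n : ℤ) - q ^ (-(n : ℤ))) / (q - q⁻¹)

/-- The balanced quantum binomial coefficient, defined via the quantum Pascal rule
`binom_q(n+1, m+1) = q^{-(n-m)} binom_q(n, m) + q^{m+1} binom_q(n, m+1)`. -/
noncomputable def qbinom {k : Type*} [Field k] (q : k) : ℕ → ℕ → k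
  | _, 0 => 1
  | 0, _ + 1 => 0
  | n + 1, m + 1 => q⁻¹ ^ (n - m) * qbinom q n m + q ^ (m + 1) * qbinom q n (m + 1)

/-- Unbalanced Gaussian binomial. -/
def gaussB {k : Type*} [Field k] (Q : k) : ℕ → ℕ → k
  | _, 0 => 1
  | 0, _ + 1 => 0
  | n + 1, m + 1 => gaussB Q n m + Q ^ (m + 1) * gaussB Q n (m + 1)

section
variable {k : Type*} [Field k]

theorem gaussB_zero (Q : k) (n : ℕ) : gaussB Q n 0 = 1 := by cases n <;> simp [gaussB]

theorem gaussB_succ (Q : k) (n m : ℕ) :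
    gaussB Q (n + 1) (m + 1) = gaussB Q n m + Q ^ (m + 1) * gaussB Q n (m + 1) := by
  simp [gaussB]

theorem gaussB_lt (Q : k) (n : ℕ) : ∀ m, n < m → gaussB Q n m = 0 := by
  induction n with
  | zero => intro m hm; obtain ⟨m, rfl⟩ := Nat.exists_eq_succ_of_ne_zero hm.ne'; simp [gaussB]
  | succ n ih =>
    intro m hm
    obtain ⟨m, rfl⟩ : ∃ m', m = m' + 1 := ⟨m - 1, by omega⟩
    rw [gaussB_succ, ih m (by omega), ih (m + 1) (by omega)]; simp

theorem gaussB_self (Q : k) (n : ℕ) : gaussB Q n n = 1 := by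
  induction n with
  | zero => simp [gaussB]
  | succ n ih => rw [gaussB_succ, ih, gaussB_lt Q n (n + 1) (by omega)]; simp

theorem gaussB_rec (Q : k) (n : ℕ) :
    ∀ m, Q ^ m * (Q ^ (m + 1) - 1) * gaussB Q n (m + 1) = (Q ^ n - Q ^ m) * gaussB Q n m := by
  induction n with
  | zero =>
    intro m
    cases m with
    | zero => simp [gaussB]
    | succ m => simp [gaussB]
  | succ n ih =>
    intro m
    cases m with
    | zero =>
      have h := ih 0
      simp only [gaussB_succ, gaussB_zero] at h ⊢
      linear_combination Q * h
    | succ m =>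
      have h := ih m
      have h1 := ih (m + 1)
      simp only [gaussB_succ] at h h1 ⊢
      linear_combination Q ^ (m + 2) * h1 + Q * h

theorem gaussB_ell (Q : k) (ℓ : ℕ) (h1 : Q ^ ℓ = 1) (hQ : Q ≠ 0)
    (hmin : ∀ m, 0 < m → m < ℓ → Q ^ m ≠ 1) (m : ℕ) (hm : m + 1 < ℓ) :
    gaussB Q ℓ (m + 1) = 0 := by
  induction m with
  | zero =>
    have h := gaussB_rec Q ℓ 0
    have := sub_ne_zero.2 (hmin 1 (by omega) (by omega))
    simp [h1] at h
    rcases h with h | h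
    · exact absurd (by simpa using h) this
    · exact h
  | succ m ih =>
    have h := gaussB_rec Q ℓ (m + 1)
    rw [ih (by omega), mul_zero] at h
    have := sub_ne_zero.2 (hmin (m + 1 + 1) (by omega) (by omega))
    have h2 := pow_ne_zero (m + 1) hQ
    simpa [this, h2, hQ] using h

theorem gaussB_lucas (Q : k) (ℓ : ℕ) (hℓ : 2 ≤ ℓ) (h1 : Q ^ ℓ = 1) (hQ : Q ≠ 0)
    (hmin : ∀ m, 0 < m → m < ℓ → Q ^ m ≠ 1) (A : ℕ) :
    ∀ a, a < ℓ → ∀ B b, b < ℓ →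
      gaussB Q (ℓ * A + a) (ℓ * B + b) = (A.choose B : k) * gaussB Q a b := by
  have step : ∀ A a, a + 1 < ℓ → (∀ B b, b < ℓ →
      gaussB Q (ℓ * A + a) (ℓ * B + b) = (A.choose B : k) * gaussB Q a b) → (∀ B b, b < ℓ →
      gaussB Q (ℓ * A + (a + 1)) (ℓ * B + b) = (A.choose B : k) * gaussB Q (a + 1) b) := by
    intro A a ha ih B b hb
    cases b with
    | succ b =>
      have e1 := ih B b (by omega)
      have e2 := ih B (b + 1) hb
      rw [← add_assoc, ← add_assoc, gaussB_succ, gaussB_succ, e1, add_assoc, e2, pow_add, pow_mul,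
        h1, one_pow]
      ring
    | zero =>
      cases B with
      | zero => simp [gaussB_zero]
      | succ B =>
        have e1 := ih B (ℓ - 1) (by omega)
        have e2 := ih (B + 1) 0 hb
        have e : ℓ * (B + 1) + 0 = (ℓ * B + (ℓ - 1)) + 1 := by
          rw [mul_add]; omega
        rw [e] at e2 ⊢
        rw [← add_assoc, gaussB_succ, e1, e2, gaussB_lt Q a (ℓ - 1) (by omega), ← e, add_zero,
          pow_mul, h1, one_pow, gaussB_zero, gaussB_zero]
        ring
  induction A with
  | zero =>
    intro a
    induction a with
    | zero =>
      intro _ B b hb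
      cases B with
      | zero => simp
      | succ B =>
        rw [gaussB_lt Q (ℓ * 0 + 0) _ (by rw [mul_add]; omega)]
        simp
    | succ a iha => intro ha; exact step _ _ ha (iha (by omega))
  | succ A ihA =>
    intro a
    induction a with
    | succ a iha => intro ha; exact step _ _ ha (iha (by omega))
    | zero =>
      intro _ B b hb
      have eA : ℓ * (A + 1) + 0 = (ℓ * A + (ℓ - 1)) + 1 := by rw [mul_add]; omega
      have ih := ihA (ℓ - 1) (by omega)
      rw [eA]
      cases b with
      | succ b =>
        have e1 := ih B b (by omega)
        have e2 := ih B (b + 1) hb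
        have hz := gaussB_ell Q ℓ h1 hQ hmin b hb
        have el : ℓ = (ℓ - 1) + 1 := by omega
        have hz' : gaussB Q (ℓ - 1) b + Q ^ (b + 1) * gaussB Q (ℓ - 1) (b + 1) = 0 := by
          rw [← gaussB_succ, ← el, hz]
        rw [← add_assoc, gaussB_succ, e1, add_assoc, e2, pow_add, pow_mul, h1, one_pow,
          gaussB_lt Q 0 (b + 1) (by omega)]
        linear_combination (A.choose B : k) * hz'
      | zero =>
        cases B with
        | zero => simp [gaussB_zero]
        | succ B =>
          have e1 := ih B (ℓ - 1) (by omega)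
          have e2 := ih (B + 1) 0 hb
          have e : ℓ * (B + 1) + 0 = (ℓ * B + (ℓ - 1)) + 1 := by
            rw [mul_add]; omega
          rw [e] at e2 ⊢
          rw [gaussB_succ, e1, e2, gaussB_self, ← e, add_zero,
            pow_mul, h1, one_pow, gaussB_zero, gaussB_zero, Nat.choose_succ_succ]
          push_cast
          ring

theorem qbinom_eq_gaussB (q : k) (hq : q ≠ 0) (n : ℕ) :
    ∀ m, qbinom q n m = q ^ (-((m : ℤ) * ((n : ℤ) - m))) * gaussB (q ^ 2) n m := by
  induction n with
  | zero =>
    intro m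
    cases m with
    | zero => simp [qbinom, gaussB]
    | succ m => simp [qbinom, gaussB]
  | succ n ih =>
    intro m
    cases m with
    | zero => simp [qbinom, gaussB]
    | succ m =>
      rw [qbinom, gaussB_succ, ih, ih]
      rcases le_or_gt m n with h | h
      · have e1 : q⁻¹ ^ (n - m) = q ^ (-((n : ℤ) - m)) := by
          rw [zpow_neg, ← Nat.cast_sub h, zpow_natCast, inv_pow]
        have e2 : q ^ (m + 1) = q ^ ((m : ℤ) + 1) := by
          rw [← zpow_natCast]; push_cast; rfl
        have e3 : (q ^ 2) ^ (m + 1) = q ^ (2 * ((m : ℤ) + 1)) := by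
          rw [← pow_mul, ← zpow_natCast]; push_cast; rfl
        rw [e1, e2, e3, mul_add, ← mul_assoc, ← mul_assoc, ← mul_assoc, ← zpow_add₀ hq,
          ← zpow_add₀ hq, ← zpow_add₀ hq]
        push_cast
        congr 3 <;> ring_nf
      · rw [gaussB_lt _ n m h, gaussB_lt _ n (m + 1) (by omega)]; simp

theorem lucas_digits (p : ℕ) (hp : p.Prime) [CharP k p] (j : ℕ) :
    ∀ a b : ℕ → ℕ, (∀ i, a i < p) → (∀ i, b i < p) →
    (((∑ i ∈ Finset.range j, a i * p ^ i).choose (∑ i ∈ Finset.range j, b i * p ^ i) : ℕ) : k)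
      = ((∏ i ∈ Finset.range j, (a i).choose (b i) : ℕ) : k) := by
  have := Fact.mk hp
  induction j with
  | zero => intro a b _ _; simp
  | succ j ih =>
    intro a b ha hb
    have key : ∀ c : ℕ → ℕ, ∑ i ∈ Finset.range (j + 1), c i * p ^ i
        = c 0 + p * ∑ i ∈ Finset.range j, c (i + 1) * p ^ i := by
      intro c
      rw [Finset.sum_range_succ', Finset.mul_sum, add_comm]
      congr 1
      · simp
      · exact Finset.sum_congr rfl fun i _ => by ring
    have h := @Choose.choose_modEq_choose_mod_mul_choose_div_nat
      (∑ i ∈ Finset.range (j + 1), a i * p ^ i) (∑ i ∈ Finset.range (j + 1), b i * p ^ i) p _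
    have h' := (CharP.natCast_eq_natCast k p).2 h
    rw [h', key, key, Nat.add_mul_mod_self_left, Nat.add_mul_mod_self_left,
      Nat.add_mul_div_left _ _ hp.pos, Nat.add_mul_div_left _ _ hp.pos,
      Nat.mod_eq_of_lt (ha 0), Nat.mod_eq_of_lt (hb 0), Nat.div_eq_of_lt (ha 0),
      Nat.div_eq_of_lt (hb 0), zero_add, zero_add, Nat.cast_mul,
      ih (fun i => a (i + 1)) (fun i => b (i + 1)) (fun i => ha _) (fun i => hb _),
      Finset.prod_range_succ', Nat.cast_mul, mul_comm]

end

/-- The quantum Lucas theorem in mixed characteristic `(p, ℓ)`: for `V` with `pℓ`-adic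
digits `(a_j,…,a_0)` and `W` with digits `(b_j,…,b_0)`,
`binom_q(V, W) = ε · binom(a_j, b_j) ⋯ binom(a_1, b_1) · binom_q(a_0, b_0)`, where
`ε = (q^ℓ)^{A_1 b_0 + a_0 B_1 + ℓ(A_1 B_1 - B_1²)}` with `A_1 = (V-a_0)/ℓ`,
`B_1 = (W-b_0)/ℓ`. -/
theorem quantum_lucas {k : Type*} [Field k] (p ℓ : ℕ) (hp : p.Prime) (hℓ : 2 ≤ ℓ)
    [CharP k p] (q : k) (hq : q ≠ 0) (hzero : qnum q ℓ = 0)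
    (hmin : ∀ m : ℕ, 0 < m → m < ℓ → qnum q m ≠ 0)
    (j : ℕ) (a b : ℕ → ℕ) (ha0 : a 0 < ℓ) (hb0 : b 0 < ℓ)
    (hai : ∀ i, 0 < i → a i < p) (hbi : ∀ i, 0 < i → b i < p)
    (V W : ℕ) (hV : V = ∑ i ∈ Finset.range (j + 1), a i * plpow p ℓ i)
    (hW : W = ∑ i ∈ Finset.range (j + 1), b i * plpow p ℓ i) :
    qbinom q V W =
      (q ^ ℓ) ^ ((((V - a 0) / ℓ : ℕ) : ℤ) * (b 0 : ℤ) + (a 0 : ℤ) * (((W - b 0) / ℓ : ℕ) : ℤ)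
          + (ℓ : ℤ) * ((((V - a 0) / ℓ : ℕ) : ℤ) * (((W - b 0) / ℓ : ℕ) : ℤ)
            - (((W - b 0) / ℓ : ℕ) : ℤ) ^ 2)) *
        ((∏ i ∈ Finset.Icc 1 j, (a i).choose (b i) : ℕ) : k) * qbinom q (a 0) (b 0) := by
  have hq1 : q - q⁻¹ ≠ 0 := by
    intro h
    exact hmin 1 (by omega) (by omega) (by simp [qnum, h])
  have hiff : ∀ m : ℕ, qnum q m = 0 ↔ (q ^ 2) ^ m = 1 := by
    intro m
    have hm : q ^ m ≠ 0 := pow_ne_zero _ hq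
    rw [qnum, div_eq_zero_iff, or_iff_left hq1, sub_eq_zero, zpow_neg, zpow_natCast,
      ← mul_eq_one_iff_eq_inv₀ hm, ← pow_mul, mul_comm 2 m, pow_mul, sq]
  have h1 := (hiff ℓ).1 hzero
  have hm' : ∀ m, 0 < m → m < ℓ → (q ^ 2) ^ m ≠ 1 := fun m h h' e => hmin m h h' ((hiff m).2 e)
  have key : ∀ c : ℕ → ℕ, ∑ i ∈ Finset.range (j + 1), c i * plpow p ℓ i
      = ℓ * (∑ i ∈ Finset.range j, c (i + 1) * p ^ i) + c 0 := by
    intro c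
    rw [Finset.sum_range_succ', Finset.mul_sum]
    congr 1
    · exact Finset.sum_congr rfl fun i _ => by simp only [plpow]; ring
    · simp [plpow]
  have hprod : ∏ i ∈ Finset.Icc 1 j, (a i).choose (b i)
      = ∏ i ∈ Finset.range j, (a (i + 1)).choose (b (i + 1)) := by
    generalize j = n
    induction n with
    | zero => simp
    | succ n ih => rw [Finset.prod_Icc_succ_top (by omega), ih, Finset.prod_range_succ]
  have hl := lucas_digits (k := k) p hp j (fun i => a (i + 1)) (fun i => b (i + 1))
    (fun i => hai _ (by omega)) (fun i => hbi _ (by omega))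
  rw [key] at hV hW
  rw [hprod, ← hl]
  generalize (∑ i ∈ Finset.range j, a (i + 1) * p ^ i) = A at *
  generalize (∑ i ∈ Finset.range j, b (i + 1) * p ^ i) = B at *
  have hVA : (V - a 0) / ℓ = A := by
    rw [hV, Nat.add_sub_cancel, Nat.mul_div_cancel_left _ (by omega)]
  have hWB : (W - b 0) / ℓ = B := by
    rw [hW, Nat.add_sub_cancel, Nat.mul_div_cancel_left _ (by omega)]
  rw [hVA, hWB, qbinom_eq_gaussB q hq, qbinom_eq_gaussB q hq, hV, hW,
    gaussB_lucas (q ^ 2) ℓ hℓ h1 (pow_ne_zero _ hq) hm' A _ ha0 B _ hb0]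
  have hs : ∀ z : ℤ, q ^ (2 * (ℓ : ℤ) * z) = 1 := by
    intro z
    rw [zpow_mul]
    have : q ^ (2 * (ℓ : ℤ)) = 1 := by
      rw [← h1, ← pow_mul, ← zpow_natCast]; push_cast; rfl
    rw [this, one_zpow]
  have hε : ∀ e : ℤ, (q ^ ℓ) ^ e = q ^ ((ℓ : ℤ) * e) := by
    intro e; rw [zpow_mul, zpow_natCast]
  rw [hε]
  have e : q ^ (-(((ℓ * B + b 0 : ℕ) : ℤ) * (((ℓ * A + a 0 : ℕ) : ℤ) - ((ℓ * B + b 0 : ℕ) : ℤ))))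
      = q ^ ((ℓ : ℤ) * ((A : ℤ) * (b 0 : ℤ) + (a 0 : ℤ) * (B : ℤ)
          + (ℓ : ℤ) * ((A : ℤ) * (B : ℤ) - (B : ℤ) ^ 2)))
        * q ^ (-((b 0 : ℤ) * ((a 0 : ℤ) - b 0))) := by
    have hz := hs (-((A : ℤ) * (b 0 : ℤ) + (a 0 : ℤ) * (B : ℤ) - (B : ℤ) * (b 0 : ℤ)
          + (ℓ : ℤ) * ((A : ℤ) * (B : ℤ) - (B : ℤ) ^ 2)))
    rw [← zpow_add₀ hq, ← mul_one (q ^ (_ + _ : ℤ)), ← hz, ← zpow_add₀ hq]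
    congr 1
    push_cast
    ring
  rw [e]
  ring
end

section
/- Non-vanishing of the digon scalar: in mixed characteristic (p,ℓ), for eves a·p^{(k)} and b·p^{(t)} (1 ≤ a,b < p resp. ℓ as appropriate), the specialized scalar Θ̃ = (-1)^w binom_q(m+n+w+1, w)/(binom_q(m+w,w) binom_q(n+w,w)) has well-defined denominator: binom_q(m+w, w) ≠ 0 and binom_q(n+w, w) ≠ 0, because a·p^{(k)} = (m+w)+1 and b·p^{(t)} = (n+w)+1 are eves, so every pℓ-adic digit of m+w and n+w is maximal or at least the corresponding digit of w. -/
/-- Unbalanced Gaussian binomial. -/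
def gb {k : Type*} [Field k] (Q : k) : ℕ → ℕ → k
  | _, 0 => 1
  | 0, _ + 1 => 0
  | n + 1, m + 1 => gb Q n m + Q ^ (m + 1) * gb Q n (m + 1)

section
variable {k : Type*} [Field k]

theorem gb_zero (Q : k) (n : ℕ) : gb Q n 0 = 1 := by cases n <;> simp [gb]

theorem gb_succ (Q : k) (n m : ℕ) :
    gb Q (n + 1) (m + 1) = gb Q n m + Q ^ (m + 1) * gb Q n (m + 1) := by simp [gb]

theorem gb_lt (Q : k) (n : ℕ) : ∀ m, n < m → gb Q n m = 0 := by
  induction n with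
  | zero => intro m hm; obtain ⟨j, rfl⟩ : ∃ j, m = j + 1 := ⟨m - 1, by omega⟩; simp [gb]
  | succ n ih =>
    intro m hm
    obtain ⟨j, rfl⟩ : ∃ j, m = j + 1 := ⟨m - 1, by omega⟩
    rw [gb_succ, ih _ (by omega), ih _ (by omega)]; simp

theorem gb_self (Q : k) (n : ℕ) : gb Q n n = 1 := by
  induction n with
  | zero => simp [gb]
  | succ n ih => rw [gb_succ, ih, gb_lt Q n _ (by omega)]; simp

theorem gb_step (Q : k) (n : ℕ) : ∀ m,
    Q ^ m * (1 - Q ^ (m + 1)) * gb Q n (m + 1) = (Q ^ m - Q ^ n) * gb Q n m := by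
  induction n with
  | zero =>
    intro m
    cases m <;> simp [gb]
  | succ n ih =>
    intro m
    cases m with
    | zero =>
      have h := ih 0
      rw [gb_succ]
      simp only [gb_zero] at h ⊢
      linear_combination Q * h
    | succ m =>
      have h1 := ih m
      have h2 := ih (m + 1)
      rw [gb_succ, gb_succ]
      linear_combination Q ^ (m + 2) * h2 + Q * h1

theorem gb_ell (Q : k) (ℓ : ℕ) (h1 : Q ^ ℓ = 1) (hQ : Q ≠ 0)
    (hmin : ∀ x, 0 < x → x < ℓ → Q ^ x ≠ 1) :
    ∀ m, m + 1 < ℓ → gb Q ℓ (m + 1) = 0 := by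
  intro m
  induction m with
  | zero =>
    intro hm
    have h := gb_step Q ℓ 0
    have h3 := hmin 1 (by omega) (by omega)
    rw [h1] at h
    simp only [pow_zero, sub_self, zero_mul, one_mul] at h
    rcases mul_eq_zero.1 h with h | h
    · exact absurd (sub_eq_zero.1 h).symm h3
    · exact h
  | succ m ih =>
    intro hm
    have h := gb_step Q ℓ (m + 1)
    have h3 := hmin (m + 1 + 1) (by omega) (by omega)
    rw [ih (by omega), mul_zero] at h
    rcases mul_eq_zero.1 h with h | h
    · rcases mul_eq_zero.1 h with h | h
      · exact absurd h (pow_ne_zero _ hQ)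
      · exact absurd (sub_eq_zero.1 h).symm h3
    · exact h

theorem gb_small (Q : k) (ℓ : ℕ) (hQ : Q ≠ 0)
    (hmin : ∀ x, 0 < x → x < ℓ → Q ^ x ≠ 1) (r : ℕ) (hr : r < ℓ) :
    ∀ s, s ≤ r → gb Q r s ≠ 0 := by
  intro s
  induction s with
  | zero => intro _; rw [gb_zero]; exact one_ne_zero
  | succ s ih =>
    intro hs h0
    have h := gb_step Q r s
    rw [h0, mul_zero] at h
    rcases mul_eq_zero.1 h.symm with h | h
    · obtain ⟨d, rfl⟩ : ∃ d, r = s + d := ⟨r - s, by omega⟩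
      have h3 := hmin d (by omega) (by omega)
      apply h3
      have h4 : Q ^ s * (Q ^ d - 1) = 0 := by rw [pow_add] at h; linear_combination -h
      rcases mul_eq_zero.1 h4 with h | h
      · exact absurd h (pow_ne_zero _ hQ)
      · exact sub_eq_zero.1 h
    · exact ih (by omega) h

theorem gb_lucas (Q : k) (ℓ : ℕ) (hℓ : 2 ≤ ℓ) (h1 : Q ^ ℓ = 1) (hQ : Q ≠ 0)
    (hmin : ∀ x, 0 < x → x < ℓ → Q ^ x ≠ 1) (n : ℕ) :
    ∀ m, gb Q n m = (Nat.choose (n / ℓ) (m / ℓ) : k) * gb Q (n % ℓ) (m % ℓ) := by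
  have key : ∀ x, (x % ℓ + 1 < ℓ ∧ (x + 1) / ℓ = x / ℓ ∧ (x + 1) % ℓ = x % ℓ + 1) ∨
      (x % ℓ + 1 = ℓ ∧ (x + 1) / ℓ = x / ℓ + 1 ∧ (x + 1) % ℓ = 0) := by
    intro x
    have hlt := Nat.mod_lt x (show 0 < ℓ by omega)
    have hx := Nat.mod_add_div x ℓ
    by_cases h : x % ℓ + 1 < ℓ
    · left
      refine ⟨h, ?_⟩
      rw [Nat.div_mod_unique (by omega)]
      exact ⟨by omega, h⟩
    · right
      refine ⟨by omega, ?_⟩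
      rw [Nat.div_mod_unique (by omega)]
      exact ⟨by rw [mul_add]; omega, by omega⟩
  have hpow : ∀ x, Q ^ x = Q ^ (x % ℓ) := by
    intro x
    conv_lhs => rw [← Nat.mod_add_div x ℓ, pow_add, pow_mul, h1, one_pow, mul_one]
  induction n with
  | zero =>
    intro m
    rcases m with _ | m
    · simp [gb_zero]
    · rw [gb_lt Q 0 _ (by omega), Nat.zero_div, Nat.zero_mod]
      rcases key m with ⟨_, _, h⟩ | ⟨_, h, _⟩
      · rw [h, gb_lt Q 0 _ (by omega)]; simp
      · rw [h]; simp
  | succ n ih =>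
    intro m
    rcases m with _ | m
    · simp [gb_zero]
    rw [gb_succ, ih, ih, hpow (m + 1)]
    rcases key n with ⟨a1, a2, a3⟩ | ⟨a1, a2, a3⟩ <;>
      rcases key m with ⟨b1, b2, b3⟩ | ⟨b1, b2, b3⟩ <;> rw [a2, a3, b2, b3]
    · rw [gb_succ]; ring
    · rw [gb_lt Q (n % ℓ) (m % ℓ) (by omega), gb_zero, gb_zero]; simp
    · have h := gb_ell Q ℓ h1 hQ hmin (m % ℓ) b1
      rw [← a1, gb_succ] at h
      rw [a1] at h
      rw [gb_lt Q 0 _ (by omega)]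
      linear_combination (Nat.choose (n / ℓ) (m / ℓ) : k) * h
    · have : n % ℓ = m % ℓ := by omega
      rw [this, gb_self, gb_zero, gb_zero, Nat.choose_succ_succ]
      push_cast
      ring

theorem qbinom_gb (q : k) (hq : q ≠ 0) (n : ℕ) :
    ∀ m, m ≤ n → q ^ (m * (n - m)) * qbinom q n m = gb (q ^ 2) n m := by
  have hz : ∀ n m, n < m → qbinom q n m = 0 := by
    intro n
    induction n with
    | zero => intro m hm; obtain ⟨j, rfl⟩ : ∃ j, m = j + 1 := ⟨m - 1, by omega⟩; simp [qbinom]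
    | succ n ih =>
      intro m hm
      obtain ⟨j, rfl⟩ : ∃ j, m = j + 1 := ⟨m - 1, by omega⟩
      rw [qbinom, ih _ (by omega), ih _ (by omega)]; simp
  induction n with
  | zero => intro m hm; obtain rfl : m = 0 := by omega
            simp [gb, qbinom]
  | succ n ih =>
    intro m hm
    rcases m with _ | m
    · simp [gb, qbinom]
    rw [gb_succ, qbinom, ← ih m (by omega)]
    obtain ⟨d, rfl⟩ : ∃ d, n = m + d := ⟨n - m, by omega⟩
    have e1 : m + d + 1 - (m + 1) = d := by omega
    have e2 : m + d - m = d := by omega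
    have e3 : q ^ d * q⁻¹ ^ d = 1 := by rw [← mul_pow, mul_inv_cancel₀ hq, one_pow]
    rw [e1, e2]
    rcases d with _ | d
    · rw [hz _ (m + 1) (by omega), gb_lt _ _ (m + 1) (by omega)]; simp
    · rw [← ih (m + 1) (by omega)]
      have e4 : m + (d + 1) - (m + 1) = d := by omega
      rw [e4]
      linear_combination q ^ (m * (d + 1)) * qbinom q (m + (d + 1)) m * e3

end

theorem choose_eve (p : ℕ) (hp : p.Prime) (a : ℕ) (ha : 1 ≤ a) (ha2 : a < p) (i : ℕ) :
    ∀ N x, N + 1 = a * p ^ i → x ≤ N → ¬ p ∣ Nat.choose N x := by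
  have small : ∀ N x, N < p → x ≤ N → ¬ p ∣ Nat.choose N x := by
    intro N x hN hx h
    have h2 : p ∣ N.factorial := by
      rw [← Nat.choose_mul_factorial_mul_factorial hx, mul_assoc]
      exact Dvd.dvd.mul_right h _
    have := (hp.dvd_factorial).1 h2
    omega
  induction i with
  | zero => intro N x hN hx; exact small N x (by simp at hN; omega) hx
  | succ i ih =>
    intro N x hN hx h
    have := Fact.mk hp
    have hpp := hp.two_le
    have hpos : 0 < a * p ^ i := by positivity
    obtain ⟨M, hM⟩ : ∃ M, a * p ^ i = M + 1 := ⟨a * p ^ i - 1, by omega⟩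
    have hN2 : N + 1 = p * M + p := by rw [hN, pow_succ, ← mul_assoc, hM]; ring
    have hd : N / p = M ∧ N % p = p - 1 := by
      rw [Nat.div_mod_unique (by omega)]
      exact ⟨by omega, by omega⟩
    have hl := Choose.choose_modEq_choose_mod_mul_choose_div_nat (n := N) (k := x) (p := p)
    have h2 := (hl.dvd_iff dvd_rfl).1 h
    rw [hd.1, hd.2] at h2
    have := Nat.mod_lt x (show 0 < p by omega)
    rcases (hp.dvd_mul).1 h2 with h3 | h3
    · exact small _ _ (by omega) (by omega) h3
    · exact ih M (x / p) hM.symm (hd.1 ▸ Nat.div_le_div_right hx) h3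

theorem qbinom_eve_aux {k : Type*} [Field k] (p ℓ : ℕ) (hp : p.Prime) (hℓ : 2 ≤ ℓ)
    [CharP k p] (q : k) (hq : q ≠ 0) (hzero : qnum q ℓ = 0)
    (hmin : ∀ x : ℕ, 0 < x → x < ℓ → qnum q x ≠ 0)
    (a κ w m : ℕ)
    (ha1 : 1 ≤ a) (ha2 : a < if κ = 0 then ℓ else p)
    (hm : m + w + 1 = a * plpow p ℓ κ) : qbinom q (m + w) w ≠ 0 := by
  have hne : q - q⁻¹ ≠ 0 := by
    intro h
    exact hmin 1 one_pos (by omega) (by simp [qnum, h])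
  have hiff : ∀ x : ℕ, qnum q x = 0 ↔ (q ^ 2) ^ x = 1 := by
    intro x
    have hx : q ^ x ≠ 0 := pow_ne_zero _ hq
    rw [qnum, div_eq_zero_iff, or_iff_left hne, zpow_neg, zpow_natCast, sub_eq_zero,
      ← mul_eq_one_iff_eq_inv₀ hx, ← pow_add, ← pow_mul, two_mul]
  have hQ : q ^ 2 ≠ 0 := pow_ne_zero _ hq
  have h1 := (hiff ℓ).1 hzero
  have hmin' : ∀ x, 0 < x → x < ℓ → (q ^ 2) ^ x ≠ 1 :=
    fun x h h' h2 => hmin x h h' ((hiff x).2 h2)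
  intro h0
  have hg := qbinom_gb q hq (m + w) w (by omega)
  rw [h0, mul_zero] at hg
  rcases κ with _ | i
  · simp only [plpow, if_true] at hm ha2
    exact gb_small (q ^ 2) ℓ hQ hmin' (m + w) (by omega) w (by omega) hg.symm
  · simp only [plpow, Nat.add_eq_zero_iff, one_ne_zero, and_false, if_false] at hm ha2
    rw [gb_lucas (q ^ 2) ℓ hℓ h1 hQ hmin'] at hg
    have hpp := hp.two_le
    have hpos : 0 < a * p ^ i := by positivity
    obtain ⟨M, hM⟩ : ∃ M, a * p ^ i = M + 1 := ⟨a * p ^ i - 1, by omega⟩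
    have hN2 : m + w + 1 = ℓ * M + ℓ := by rw [hm, ← mul_assoc, hM]; ring
    have hd : (m + w) / ℓ = M ∧ (m + w) % ℓ = ℓ - 1 := by
      rw [Nat.div_mod_unique (by omega)]
      exact ⟨by omega, by omega⟩
    have hlt := Nat.mod_lt w (show 0 < ℓ by omega)
    have hle : w / ℓ ≤ M := hd.1 ▸ Nat.div_le_div_right (by omega)
    rw [hd.1, hd.2] at hg
    rcases mul_eq_zero.1 hg.symm with h | h
    · exact choose_eve p hp a ha1 ha2 i M _ hM.symm hle ((CharP.cast_eq_zero_iff k p _).1 h)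
    · exact gb_small (q ^ 2) ℓ hQ hmin' (ℓ - 1) (by omega) _ (by omega) h

/-- Non-vanishing of the digon denominator: in mixed characteristic `(p, ℓ)`, for eves
`a·p^{(κ)} = m + w + 1` and `b·p^{(t)} = n + w + 1` (with `1 ≤ a < p` resp. `< ℓ` as
appropriate, and `(a·p^{(κ)} - 1) + (b·p^{(t)} - 1) = 2w + (v-1)`), the quantum binomials
`binom_q(m+w, w)` and `binom_q(n+w, w)` are nonzero in `k`. -/
theorem qbinom_eve_ne_zero {k : Type*} [Field k] (p ℓ : ℕ) (hp : p.Prime) (hℓ : 2 ≤ ℓ)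
    [CharP k p] (q : k) (hq : q ≠ 0) (hzero : qnum q ℓ = 0)
    (hmin : ∀ x : ℕ, 0 < x → x < ℓ → qnum q x ≠ 0)
    (a b κ t w m n v : ℕ)
    (ha1 : 1 ≤ a) (ha2 : a < if κ = 0 then ℓ else p)
    (hb1 : 1 ≤ b) (hb2 : b < if t = 0 then ℓ else p)
    (hm : m + w + 1 = a * plpow p ℓ κ) (hn : n + w + 1 = b * plpow p ℓ t)
    (hv : 1 ≤ v)
    (hsum : (a * plpow p ℓ κ - 1) + (b * plpow p ℓ t - 1) = 2 * w + (v - 1)) :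
    qbinom q (m + w) w ≠ 0 ∧ qbinom q (n + w) w ≠ 0 := by
  exact ⟨qbinom_eve_aux p ℓ hp hℓ q hq hzero hmin a κ w m ha1 ha2 hm,
    qbinom_eve_aux p ℓ hp hℓ q hq hzero hmin b t w n hb1 hb2 hn⟩
end
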